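/- arXiv:1306.5464 — 3 statements merged into one kernel-verified Lean document; each statement's English description precedes it below -/
import Mathlib

section
/- If s and t are sequences in SE_n (subexcedant sequences of length n) such that t is the successor of s in SE_n with respect to the Reflected Gray Code order ≺, then s and t differ in exactly one position, and at that position the values differ by exactly 1 (the list of SE_n in ≺ order is a 1-Gray code). -/
/-- Ascent statistic of the prefix `s 1, …, s k` (sequences are 1-indexed). -/
def ascStat (s : ℕ → ℕ) (k : ℕ) : ℕ :=
  ((Finset.Ico 1 k).filter (fun i => s i < s (i + 1))).card

/-- Maximum statistic of the prefix `s 1, …, s k`. -/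
def maxStat (s : ℕ → ℕ) (k : ℕ) : ℕ :=
  (Finset.Icc 1 k).sup s

/-- Length statistic of the prefix `s 1, …, s k` (its length minus one). -/
def lenStat (_ : ℕ → ℕ) (k : ℕ) : ℕ := k - 1

/-- Last-value statistic of the prefix `s 1, …, s k`. -/
def lvStat (s : ℕ → ℕ) (k : ℕ) : ℕ := s k

/-- Subexcedant sequences of length `n` (positions `1,…,n`). -/
def memSE (n : ℕ) (s : ℕ → ℕ) : Prop :=
  s 1 = 0 ∧ ∀ k, 1 ≤ k → k < n → s (k + 1) ≤ k

/-- Ascent sequences of length `n`. -/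
def memA (n : ℕ) (s : ℕ → ℕ) : Prop :=
  s 1 = 0 ∧ ∀ k, 1 ≤ k → k < n → s (k + 1) ≤ ascStat s k + 1

/-- Restricted growth functions of length `n`. -/
def memR (n : ℕ) (s : ℕ → ℕ) : Prop :=
  s 1 = 0 ∧ ∀ k, 1 ≤ k → k < n → s (k + 1) ≤ maxStat s k + 1

/-- Staircase words of length `n`. -/
def memS (n : ℕ) (s : ℕ → ℕ) : Prop :=
  s 1 = 0 ∧ ∀ k, 1 ≤ k → k < n → s (k + 1) ≤ s k + 1

/-- The Reflected Gray Code order `≺` on length-`n` sequences: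
at the leftmost position `k` where `s` and `t` differ, either the sum of the
first `k-1` entries of `s` is even and `s k < t k`, or it is odd and `s k > t k`. -/
def rgcLt (n : ℕ) (s t : ℕ → ℕ) : Prop :=
  ∃ k, 1 ≤ k ∧ k ≤ n ∧ (∀ i, 1 ≤ i → i < k → s i = t i) ∧ s k ≠ t k ∧
    ((Even (∑ i ∈ Finset.Ico 1 k, s i) ∧ s k < t k) ∨
     (¬ Even (∑ i ∈ Finset.Ico 1 k, s i) ∧ t k < s k))

/-- The Co-Reflected Gray Code order `≺_c` on length-`n` sequences:
at the rightmost position `k` where `s` and `t` differ, either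
`(∑_{i=k+1}^{n} s i) + (n-k)` is even and `s k > t k`, or it is odd and `s k < t k`. -/
def corgcLt (n : ℕ) (s t : ℕ → ℕ) : Prop :=
  ∃ k, 1 ≤ k ∧ k ≤ n ∧ (∀ i, k < i → i ≤ n → s i = t i) ∧ s k ≠ t k ∧
    ((Even ((∑ i ∈ Finset.Ioc k n, s i) + (n - k)) ∧ t k < s k) ∨
     (¬ Even ((∑ i ∈ Finset.Ioc k n, s i) + (n - k)) ∧ s k < t k))

/-- `t` is the successor of `s` in the set `X` with respect to the order `lt`. -/
def IsSuccessor (X : (ℕ → ℕ) → Prop) (lt : (ℕ → ℕ) → (ℕ → ℕ) → Prop)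
    (s t : ℕ → ℕ) : Prop :=
  X s ∧ X t ∧ lt s t ∧ ¬ ∃ u, X u ∧ lt s u ∧ lt u t

/-- `b` (read at positions `k+1,…,n`) is an admissible suffix in `X`. -/
def AdmissibleSuffix (X : (ℕ → ℕ) → Prop) (n k : ℕ) (b : ℕ → ℕ) : Prop :=
  ∃ s, X s ∧ ∀ i, k < i → i ≤ n → s i = b i

/-- `α_X(b)`: the set of values `x` such that `x b_{k+1} … b_n` is an admissible
suffix in `X` (occupying positions `k,…,n`). -/
def alphaSet (X : (ℕ → ℕ) → Prop) (n k : ℕ) (b : ℕ → ℕ) : Set ℕ :=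
  {x | ∃ s, X s ∧ s k = x ∧ ∀ i, k < i → i ≤ n → s i = b i}

/-- `μ_X(b)`: the minimum value of the statistic `st` on the length-`(k+1)` prefix
`s_1 … s_k b_{k+1}` over all sequences `s` in `X` having suffix `b` at positions
`k+1,…,n`. -/
noncomputable def muVal (X : (ℕ → ℕ) → Prop) (st : (ℕ → ℕ) → ℕ → ℕ) (n k : ℕ) (b : ℕ → ℕ) : ℕ :=
  sInf {v | ∃ s, X s ∧ (∀ i, k < i → i ≤ n → s i = b i) ∧ st s (k + 1) = v}

theorem memSE_update {n : ℕ} {s t : ℕ → ℕ} (hs : memSE n s) (ht : memSE n t) {m c : ℕ}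
    (hc : c ≤ max (s m) (t m)) : memSE n (Function.update s m c) := by
  obtain ⟨hs1, hs⟩ := hs
  obtain ⟨ht1, ht⟩ := ht
  refine ⟨?_, fun k hk hkn => ?_⟩
  · by_cases h : 1 = m
    · subst h
      simp_all
    · rw [Function.update_of_ne h, hs1]
  · have h1 := hs k hk hkn
    have h2 := ht k hk hkn
    by_cases h : k + 1 = m
    · subst h
      rw [Function.update_self]
      exact hc.trans (max_le h1 h2)
    · rwa [Function.update_of_ne h]

theorem sum_Ico_one_congr {s t : ℕ → ℕ} {k : ℕ} (h : ∀ i, 1 ≤ i → i < k → s i = t i) :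
    ∑ i ∈ Finset.Ico 1 k, s i = ∑ i ∈ Finset.Ico 1 k, t i :=
  Finset.sum_congr rfl fun i hi => h i (Finset.mem_Ico.1 hi).1 (Finset.mem_Ico.1 hi).2

/-- Two sequences that differ at exactly one position below `m`, by one, have prefix sums of
opposite parity. -/
theorem even_sum_Ico_one_iff_not {s t : ℕ → ℕ} {k m : ℕ} (hk : 1 ≤ k) (hkm : k < m)
    (hst : s k = t k + 1 ∨ t k = s k + 1)
    (h : ∀ i, 1 ≤ i → i < m → i ≠ k → s i = t i) :
    Even (∑ i ∈ Finset.Ico 1 m, s i) ↔ ¬ Even (∑ i ∈ Finset.Ico 1 m, t i) := by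
  have hmem : k ∈ Finset.Ico 1 m := Finset.mem_Ico.2 ⟨hk, hkm⟩
  have hrest : ∑ i ∈ (Finset.Ico 1 m).erase k, s i = ∑ i ∈ (Finset.Ico 1 m).erase k, t i :=
    Finset.sum_congr rfl fun i hi => by
      obtain ⟨hne, hi⟩ := Finset.mem_erase.1 hi
      exact h i (Finset.mem_Ico.1 hi).1 (Finset.mem_Ico.1 hi).2 hne
  rw [← Finset.add_sum_erase _ s hmem, ← Finset.add_sum_erase _ t hmem, hrest]
  simp only [Nat.even_iff]
  omega

theorem rgcLt_update_right {n m c : ℕ} {s : ℕ → ℕ} (hm : 1 ≤ m) (hmn : m ≤ n)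
    (h : (Even (∑ i ∈ Finset.Ico 1 m, s i) ∧ s m < c) ∨
      (¬ Even (∑ i ∈ Finset.Ico 1 m, s i) ∧ c < s m)) :
    rgcLt n s (Function.update s m c) := by
  refine ⟨m, hm, hmn, fun i _ hi => by rw [Function.update_of_ne hi.ne], ?_, ?_⟩ <;>
    rw [Function.update_self]
  · omega
  · exact h

theorem rgcLt_update_left {n m c : ℕ} {t : ℕ → ℕ} (hm : 1 ≤ m) (hmn : m ≤ n)
    (h : (Even (∑ i ∈ Finset.Ico 1 m, t i) ∧ c < t m) ∨
      (¬ Even (∑ i ∈ Finset.Ico 1 m, t i) ∧ t m < c)) :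
    rgcLt n (Function.update t m c) t := by
  have hpre : ∀ i, 1 ≤ i → i < m → Function.update t m c i = t i := fun i _ hi => by
    rw [Function.update_of_ne hi.ne]
  refine ⟨m, hm, hmn, hpre, ?_, ?_⟩
  · rw [Function.update_self]
    omega
  · rwa [sum_Ico_one_congr hpre, Function.update_self]


/-- Successive subexcedant sequences in the RGC order differ in
exactly one position, and by exactly 1 there (1-Gray code). -/
theorem rgc_subexcedant_one_gray_code
    (n : ℕ) (s t : ℕ → ℕ) (hsucc : IsSuccessor (memSE n) (rgcLt n) s t) :
    ∃ k, 1 ≤ k ∧ k ≤ n ∧ (s k = t k + 1 ∨ t k = s k + 1) ∧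
      ∀ i, 1 ≤ i → i ≤ n → i ≠ k → s i = t i := by
  obtain ⟨hs, ht, ⟨k, hk, hkn, hpre, hne, hlt⟩, hno⟩ := hsucc
  have hsum := sum_Ico_one_congr hpre
  have hstep : s k = t k + 1 ∨ t k = s k + 1 := by
    by_contra! hgap
    obtain ⟨c, hc, hsc, hct⟩ : ∃ c, c ≤ max (s k) (t k) ∧
        ((Even (∑ i ∈ Finset.Ico 1 k, s i) ∧ s k < c) ∨
          (¬ Even (∑ i ∈ Finset.Ico 1 k, s i) ∧ c < s k)) ∧
        ((Even (∑ i ∈ Finset.Ico 1 k, s i) ∧ c < t k) ∨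
          (¬ Even (∑ i ∈ Finset.Ico 1 k, s i) ∧ t k < c)) := by
      rcases hlt with ⟨he, h⟩ | ⟨he, h⟩
      · exact ⟨s k + 1, by omega, .inl ⟨he, by omega⟩, .inl ⟨he, by omega⟩⟩
      · exact ⟨t k + 1, by omega, .inr ⟨he, by omega⟩, .inr ⟨he, by omega⟩⟩
    have hupd : ∀ i, 1 ≤ i → i < k → Function.update s k c i = s i := fun i _ hi => by
      rw [Function.update_of_ne hi.ne]
    refine hno ⟨_, memSE_update hs ht hc, rgcLt_update_right hk hkn hsc, k, hk, hkn,
      fun i h1 hi => (hupd i h1 hi).trans (hpre i h1 hi), ?_, ?_⟩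
    · rw [Function.update_self]
      omega
    · rwa [sum_Ico_one_congr hupd, Function.update_self]
  refine ⟨k, hk, hkn, hstep, ?_⟩
  by_contra! hex
  obtain ⟨⟨hm1, hmn, hmk, hm⟩, hmin⟩ := And.intro (Nat.find_spec hex) fun i => Nat.find_min hex (m := i)
  set m := Nat.find hex
  have hkm : k < m := by
    by_contra hle
    exact hm (hpre m hm1 (by omega))
  have hpar := even_sum_Ico_one_iff_not hk hkm hstep fun i h1 hi hik => by
    by_contra hi'
    exact hmin i hi ⟨h1, by omega, hik, hi'⟩
  by_cases hup : (Even (∑ i ∈ Finset.Ico 1 m, s i) ∧ s m < t m) ∨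
      (¬ Even (∑ i ∈ Finset.Ico 1 m, s i) ∧ t m < s m)
  · have hupd : ∀ i, i ≤ k → Function.update s m (t m) i = s i := fun i hi => by
      rw [Function.update_of_ne (by omega)]
    refine hno ⟨_, memSE_update hs ht (le_max_right _ _), rgcLt_update_right hm1 hmn hup,
      k, hk, hkn, fun i h1 hi => (hupd i hi.le).trans (hpre i h1 hi), ?_, ?_⟩
    · rwa [hupd k le_rfl]
    · rwa [sum_Ico_one_congr fun i _ hi => hupd i hi.le, hupd k le_rfl]
  · have hupd : ∀ i, i ≤ k → Function.update t m (s m) i = t i := fun i hi => by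
      rw [Function.update_of_ne (by omega)]
    have hdown : (Even (∑ i ∈ Finset.Ico 1 m, t i) ∧ s m < t m) ∨
        (¬ Even (∑ i ∈ Finset.Ico 1 m, t i) ∧ t m < s m) := by
      rcases lt_or_gt_of_ne hm with h | h <;> tauto
    refine hno ⟨_, memSE_update ht hs (le_max_right _ _),
      ⟨k, hk, hkn, fun i h1 hi => (hpre i h1 hi).trans (hupd i hi.le).symm, ?_, ?_⟩,
      rgcLt_update_left hm1 hmn hdown⟩ <;> rwa [hupd k le_rfl]
end

section
/- Let b be an admissible suffix in A_n. If b is the empty sequence, then α_A(b) = {0,1,…,n−1}. If b = b_{k+1} b_{k+2} … b_n with 1 ≤ k < n, then: α_A(b) = {k−1} if μ_A(b) = k, or if μ_A(b) = k−1 and b_{k+1} = 0; α_A(b) = {0,1,…,b_{k+1}−1} ∪ {k−1} if μ_A(b) = k−1 and 0 < b_{k+1} < k; and α_A(b) = {0,1,…,k−1} if μ_A(b) < k−1. -/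
theorem ascStat_one (s : ℕ → ℕ) : ascStat s 1 = 0 := by simp [ascStat]

theorem ascStat_succ (s : ℕ → ℕ) {k : ℕ} (hk : 1 ≤ k) :
    ascStat s (k + 1) = ascStat s k + if s k < s (k + 1) then 1 else 0 := by
  unfold ascStat
  rw [Finset.card_filter, Finset.card_filter, Finset.sum_Ico_succ_top hk]

theorem ascStat_le (s : ℕ → ℕ) {k : ℕ} (hk : 1 ≤ k) : ascStat s k ≤ k - 1 := by
  induction k, hk using Nat.le_induction with
  | base => simp [ascStat_one]
  | succ k hk ih =>
    rw [ascStat_succ s hk]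
    split_ifs <;> omega

theorem memA_le {n : ℕ} {s : ℕ → ℕ} (hs : memA n s) {k : ℕ} (hk : 1 ≤ k) (hkn : k ≤ n) :
    s k ≤ k - 1 := by
  obtain ⟨h1, h2⟩ := hs
  rcases Nat.exists_eq_add_of_le' hk with ⟨m, rfl⟩
  rcases Nat.eq_zero_or_pos m with rfl | hm
  · simp [h1]
  · have := h2 m hm (by omega)
    have := ascStat_le s hm
    omega

/-- If every position of a prefix is an ascent, then its last value is maximal. -/
theorem memA_eq_of_le_ascStat {n : ℕ} {s : ℕ → ℕ} (hs : memA n s) {k : ℕ} (hk : 1 ≤ k)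
    (hkn : k ≤ n) (h : k - 1 ≤ ascStat s k) : s k = k - 1 := by
  induction k, hk using Nat.le_induction with
  | base => exact hs.1
  | succ k hk ih =>
    have hle := memA_le hs (k := k + 1) (by omega) hkn
    have := ascStat_le s hk
    rw [ascStat_succ s hk] at h
    split_ifs at h with hlt
    · have := ih (by omega) (by omega)
      omega
    · omega

/-- The sequence `0, 1, …, k - 2, x, b (k + 1), b (k + 2), …`. -/
def staircaseThen (k x : ℕ) (b : ℕ → ℕ) (i : ℕ) : ℕ :=
  if i < k then i - 1 else if i = k then x else b i

theorem staircaseThen_of_lt {k x i : ℕ} (b : ℕ → ℕ) (h : i < k) :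
    staircaseThen k x b i = i - 1 := by simp [staircaseThen, h]

theorem staircaseThen_self (k x : ℕ) (b : ℕ → ℕ) : staircaseThen k x b k = x := by
  simp [staircaseThen]

theorem staircaseThen_of_gt {k x i : ℕ} (b : ℕ → ℕ) (h : k < i) :
    staircaseThen k x b i = b i := by
  simp [staircaseThen, h.ne', h.not_gt]

theorem ascStat_staircaseThen_of_lt {k x j : ℕ} (b : ℕ → ℕ) (hj : 1 ≤ j) (h : j < k) :
    ascStat (staircaseThen k x b) j = j - 1 := by
  induction j, hj using Nat.le_induction with
  | base => simp [ascStat_one]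
  | succ j hj ih =>
    rw [ascStat_succ _ hj, ih (by omega), staircaseThen_of_lt b h,
      staircaseThen_of_lt b (by omega), if_pos (by omega)]
    omega

theorem ascStat_staircaseThen_self {k x : ℕ} (b : ℕ → ℕ) (hk : 1 ≤ k) :
    ascStat (staircaseThen k x b) k = k - 2 + if k - 2 < x ∧ 2 ≤ k then 1 else 0 := by
  rcases Nat.exists_eq_add_of_le' hk with ⟨m, rfl⟩
  rcases Nat.eq_zero_or_pos m with rfl | hm
  · simp [ascStat_one]
  · rw [ascStat_succ _ hm, ascStat_staircaseThen_of_lt b hm (by omega), staircaseThen_self,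
      staircaseThen_of_lt b (by omega)]
    split_ifs <;> omega

theorem ascStat_staircaseThen_succ {k x : ℕ} (b : ℕ → ℕ) (hk : 1 ≤ k) :
    ascStat (staircaseThen k x b) (k + 1) =
      k - 2 + (if k - 2 < x ∧ 2 ≤ k then 1 else 0) + if x < b (k + 1) then 1 else 0 := by
  rw [ascStat_succ _ hk, ascStat_staircaseThen_self b hk, staircaseThen_self,
    staircaseThen_of_gt b (by omega)]

theorem staircaseThen_apply_one {k x : ℕ} (b : ℕ → ℕ) (hk : 1 ≤ k) (hx : x < k) :
    staircaseThen k x b 1 = 0 := by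
  unfold staircaseThen
  split_ifs <;> omega

theorem staircaseThen_le_ascStat {k x j : ℕ} (b : ℕ → ℕ) (hx : x < k) (hj : 1 ≤ j)
    (hjk : j < k) :
    staircaseThen k x b (j + 1) ≤ ascStat (staircaseThen k x b) j + 1 := by
  rw [ascStat_staircaseThen_of_lt b hj hjk]
  unfold staircaseThen
  split_ifs <;> omega

/-- Replacing the prefix of an ascent sequence by one with at least as many ascents keeps it an
ascent sequence, provided that the new sequence is admissible at the junction. -/
theorem memA_staircaseThen {n k x : ℕ} {b u : ℕ → ℕ} (hk : 1 ≤ k) (hx : x < k)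
    (hu : memA n u) (hub : ∀ i, k < i → i ≤ n → u i = b i)
    (hasc : ascStat u (k + 1) ≤ ascStat (staircaseThen k x b) (k + 1))
    (hb : b (k + 1) ≤ ascStat (staircaseThen k x b) k + 1) :
    memA n (staircaseThen k x b) := by
  have mono : ∀ j, k + 1 ≤ j → j ≤ n → ascStat u j ≤ ascStat (staircaseThen k x b) j := by
    intro j hj
    induction j, hj using Nat.le_induction with
    | base => exact fun _ => hasc
    | succ j hj ih =>
      intro hjn
      rw [ascStat_succ _ (by omega), ascStat_succ _ (by omega), hub j (by omega) (by omega),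
        hub (j + 1) (by omega) hjn, staircaseThen_of_gt b (by omega),
        staircaseThen_of_gt b (by omega)]
      have := ih (by omega)
      omega
  refine ⟨staircaseThen_apply_one b hk hx, fun j hj hjn => ?_⟩
  rcases lt_trichotomy j k with h | rfl | h
  · exact staircaseThen_le_ascStat b hx hj h
  · rwa [staircaseThen_of_gt b (by omega)]
  · rw [staircaseThen_of_gt b (by omega), ← hub (j + 1) (by omega) (by omega)]
    have := hu.2 j hj hjn
    have := mono j h hjn.le
    omega

/-- Characterization of `α_A(b)` for admissible suffixes in `A_n`. -/
theorem alpha_A_characterization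
    (n : ℕ) (hn : 1 ≤ n) :
    (∀ b : ℕ → ℕ, alphaSet (memA n) n n b = Set.Iio n) ∧
    (∀ k, 1 ≤ k → k < n → ∀ b : ℕ → ℕ, AdmissibleSuffix (memA n) n k b →
      ((muVal (memA n) ascStat n k b = k ∨
          (muVal (memA n) ascStat n k b = k - 1 ∧ b (k + 1) = 0)) →
        alphaSet (memA n) n k b = {k - 1}) ∧
      ((muVal (memA n) ascStat n k b = k - 1 ∧ 0 < b (k + 1) ∧ b (k + 1) < k) →
        alphaSet (memA n) n k b = Set.Iio (b (k + 1)) ∪ {k - 1}) ∧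
      (muVal (memA n) ascStat n k b < k - 1 →
        alphaSet (memA n) n k b = Set.Iio k)) := by
  refine ⟨fun b => ?_, fun k hk hkn b hadm => ?_⟩
  · ext x
    simp only [alphaSet, Set.mem_ofPred_eq, Set.mem_Iio]
    constructor
    · rintro ⟨s, hs, rfl, -⟩
      have := memA_le hs hn le_rfl
      omega
    · intro hx
      exact ⟨staircaseThen n x b, ⟨staircaseThen_apply_one b hn hx,
        fun j hj hjn => staircaseThen_le_ascStat b hx hj hjn⟩, staircaseThen_self n x b,
        fun i h1 h2 => by omega⟩
  have hmin : ∀ s, memA n s → (∀ i, k < i → i ≤ n → s i = b i) →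
      muVal (memA n) ascStat n k b ≤ ascStat s (k + 1) := fun s hs hsb =>
    Nat.sInf_le ⟨s, hs, hsb, rfl⟩
  obtain ⟨u, hu, hub, hmu⟩ : ∃ u, memA n u ∧ (∀ i, k < i → i ≤ n → u i = b i) ∧
      ascStat u (k + 1) = muVal (memA n) ascStat n k b := by
    obtain ⟨s, hs, hsb⟩ := hadm
    exact Nat.sInf_mem (s := {v | ∃ s, memA n s ∧ (∀ i, k < i → i ≤ n → s i = b i) ∧
      ascStat s (k + 1) = v}) ⟨_, s, hs, hsb, rfl⟩
  have hmax : ∀ s, memA n s → (∀ i, k < i → i ≤ n → s i = b i) →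
      k - 1 + (if s k < b (k + 1) then 1 else 0) ≤ muVal (memA n) ascStat n k b →
      s k = k - 1 := by
    intro s hs hsb h
    have h1 := hmin s hs hsb
    rw [ascStat_succ s hk, hsb (k + 1) (by omega) (by omega)] at h1
    exact memA_eq_of_le_ascStat hs hk hkn.le (by omega)
  have hub1 : u (k + 1) ≤ ascStat u k + 1 := hu.2 k hk hkn
  have husucc := ascStat_succ u hk
  rw [hub (k + 1) (by omega) (by omega)] at hub1 husucc
  generalize muVal (memA n) ascStat n k b = μ at *
  refine ⟨fun h => ?_, fun h => ?_, fun h => ?_⟩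
  · have key : ∀ s, memA n s → (∀ i, k < i → i ≤ n → s i = b i) → s k = k - 1 := by
      intro s hs hsb
      apply hmax s hs hsb
      split_ifs <;> omega
    ext x
    simp only [alphaSet, Set.mem_ofPred_eq, Set.mem_singleton_iff]
    constructor
    · rintro ⟨s, hs, rfl, hsb⟩
      exact key s hs hsb
    · rintro rfl
      exact ⟨u, hu, key u hu hub, hub⟩
  · obtain ⟨h1, h2, h3⟩ := h
    ext x
    simp only [alphaSet, Set.mem_ofPred_eq, Set.mem_union, Set.mem_Iio, Set.mem_singleton_iff]
    constructor
    · rintro ⟨s, hs, rfl, hsb⟩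
      by_cases hlt : s k < b (k + 1)
      · exact Or.inl hlt
      · exact Or.inr (hmax s hs hsb (by rw [if_neg hlt]; omega))
    · intro hx
      refine ⟨staircaseThen k x b, memA_staircaseThen hk (by omega) hu hub ?_ ?_,
        staircaseThen_self k x b, fun i hi _ => staircaseThen_of_gt b hi⟩
      · rw [ascStat_staircaseThen_succ b hk]
        split_ifs <;> omega
      · rw [ascStat_staircaseThen_self b hk]
        split_ifs <;> omega
  · ext x
    simp only [alphaSet, Set.mem_ofPred_eq, Set.mem_Iio]
    constructor
    · rintro ⟨s, hs, rfl, -⟩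
      have := memA_le hs hk hkn.le
      omega
    · intro hx
      refine ⟨staircaseThen k x b, memA_staircaseThen hk hx hu hub ?_ ?_,
        staircaseThen_self k x b, fun i hi _ => staircaseThen_of_gt b hi⟩
      · rw [ascStat_staircaseThen_succ b hk]
        omega
      · rw [ascStat_staircaseThen_self b hk]
        omega
end

section
/- Let b be an admissible suffix in R_n. If b is the empty sequence, then α_R(b) = {0,1,…,n−1}. If b = b_{k+1} b_{k+2} … b_n with 1 ≤ k < n, then: α_R(b) = {k−1} if μ_R(b) = k, or if μ_R(b) = k−1 and b_{k+1} < k−1; and α_R(b) = {0,1,…,k−1} if μ_R(b) = k−1 and b_{k+1} = k−1, or if μ_R(b) < k−1. -/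
theorem maxStat_succ (s : ℕ → ℕ) (k : ℕ) :
    maxStat s (k + 1) = max (maxStat s k) (s (k + 1)) := by
  unfold maxStat
  rw [← Finset.insert_Icc_right_eq_Icc_add_one (by omega), Finset.sup_insert, sup_comm]

theorem le_maxStat (s : ℕ → ℕ) {i k : ℕ} (hi : 1 ≤ i) (hk : i ≤ k) : s i ≤ maxStat s k :=
  Finset.le_sup (f := s) (Finset.mem_Icc.2 ⟨hi, hk⟩)

theorem maxStat_lt_of_memR {n : ℕ} {s : ℕ → ℕ} (hs : memR n s) {k : ℕ} (hk : 1 ≤ k)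
    (hkn : k ≤ n) : maxStat s k < k := by
  induction k, hk using Nat.le_induction with
  | base => simp [maxStat, hs.1]
  | succ k hk ih =>
    have := hs.2 k hk (by omega)
    have := ih (by omega)
    rw [maxStat_succ]
    omega

theorem eq_pred_of_pred_le_maxStat {n : ℕ} {s : ℕ → ℕ} (hs : memR n s) {k : ℕ} (hk : 1 ≤ k)
    (hkn : k ≤ n) (h : k - 1 ≤ maxStat s k) : s k = k - 1 := by
  obtain _ | _ | k := k
  · omega
  · simpa using hs.1
  · have := maxStat_lt_of_memR hs (k := k + 1) (by omega) (by omega)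
    have hlt := maxStat_lt_of_memR hs hk hkn
    rw [maxStat_succ] at h hlt
    omega

theorem maxStat_mono_of_eq_suffix {s u : ℕ → ℕ} {k n : ℕ} (heq : ∀ i, k < i → i ≤ n → u i = s i)
    (hmax : maxStat s (k + 1) ≤ maxStat u (k + 1)) {j : ℕ} (hkj : k + 1 ≤ j) (hjn : j ≤ n) :
    maxStat s j ≤ maxStat u j := by
  induction j, hkj using Nat.le_induction with
  | base => exact hmax
  | succ j hj ih =>
    have := ih (by omega)
    rw [maxStat_succ, maxStat_succ, heq (j + 1) (by omega) hjn]
    exact max_le_max_right _ this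

/-- Replacing a prefix of a restricted growth function by another one with a sufficiently large
maximum gives a restricted growth function. -/
theorem memR_of_eq_suffix {s u : ℕ → ℕ} {k n : ℕ} (hs : memR n s) (hu : memR k u)
    (heq : ∀ i, k < i → i ≤ n → u i = s i)
    (hmax : maxStat s (k + 1) ≤ maxStat u (k + 1)) (hle : u (k + 1) ≤ maxStat u k + 1) :
    memR n u := by
  refine ⟨hu.1, fun j hj hjn => ?_⟩
  rcases lt_trichotomy j k with h | rfl | h
  · exact hu.2 j hj h
  · exact hle
  · rw [heq (j + 1) (by omega) hjn]
    have := maxStat_mono_of_eq_suffix heq hmax h hjn.le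
    have := hs.2 j hj hjn
    omega

/-- The sequence `0, 1, …, k - 2, x` followed by the entries of `s` after position `k`. -/
def climbThen (k x : ℕ) (s : ℕ → ℕ) (i : ℕ) : ℕ :=
  if i < k then i - 1 else if i = k then x else s i

theorem climbThen_self (k x : ℕ) (s : ℕ → ℕ) : climbThen k x s k = x := by
  simp [climbThen]

theorem climbThen_of_lt {k x i : ℕ} (s : ℕ → ℕ) (h : k < i) : climbThen k x s i = s i := by
  simp [climbThen, h.ne', h.not_gt]

theorem le_maxStat_climbThen {k x : ℕ} (s : ℕ → ℕ) : k - 2 ≤ maxStat (climbThen k x s) k := by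
  by_cases h : 2 ≤ k
  · have := le_maxStat (climbThen k x s) (i := k - 1) (k := k) (by omega) (by omega)
    rwa [climbThen, if_pos (by omega), Nat.sub_sub] at this
  · omega

theorem memR_climbThen {k x : ℕ} (hx : x < k) (s : ℕ → ℕ) : memR k (climbThen k x s) := by
  constructor
  · unfold climbThen
    split_ifs <;> omega
  · intro j hj hjk
    have := le_maxStat (climbThen k x s) hj le_rfl
    have h1 : climbThen k x s j = j - 1 := if_pos hjk
    have : climbThen k x s (j + 1) ≤ j := by
      unfold climbThen
      split_ifs <;> omega
    omega

theorem muVal_le {X : (ℕ → ℕ) → Prop} (st : (ℕ → ℕ) → ℕ → ℕ) {n k : ℕ} {b s : ℕ → ℕ} (hs : X s)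
    (hb : ∀ i, k < i → i ≤ n → s i = b i) : muVal X st n k b ≤ st s (k + 1) :=
  Nat.sInf_le ⟨s, hs, hb, rfl⟩

theorem exists_eq_muVal {X : (ℕ → ℕ) → Prop} (st : (ℕ → ℕ) → ℕ → ℕ) {n k : ℕ} {b : ℕ → ℕ}
    (h : AdmissibleSuffix X n k b) :
    ∃ s, X s ∧ (∀ i, k < i → i ≤ n → s i = b i) ∧ st s (k + 1) = muVal X st n k b := by
  obtain ⟨s, hs, hb⟩ := h
  exact Nat.sInf_mem (s := {v | ∃ s, X s ∧ (∀ i, k < i → i ≤ n → s i = b i) ∧ st s (k + 1) = v})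
    ⟨_, s, hs, hb, rfl⟩

theorem alphaSet_memR_subset_Iio {n k : ℕ} (hk : 1 ≤ k) (hkn : k ≤ n) (b : ℕ → ℕ) :
    alphaSet (memR n) n k b ⊆ Set.Iio k := by
  rintro x ⟨s, hs, rfl, -⟩
  exact (le_maxStat s hk le_rfl).trans_lt (maxStat_lt_of_memR hs hk hkn)

/-- Characterization of `α_R(b)` for admissible suffixes in `R_n`. -/
theorem alpha_R_characterization
    (n : ℕ) (hn : 1 ≤ n) :
    (∀ b : ℕ → ℕ, alphaSet (memR n) n n b = Set.Iio n) ∧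
    (∀ k, 1 ≤ k → k < n → ∀ b : ℕ → ℕ, AdmissibleSuffix (memR n) n k b →
      ((muVal (memR n) maxStat n k b = k ∨
          (muVal (memR n) maxStat n k b = k - 1 ∧ b (k + 1) < k - 1)) →
        alphaSet (memR n) n k b = {k - 1}) ∧
      (((muVal (memR n) maxStat n k b = k - 1 ∧ b (k + 1) = k - 1) ∨
          muVal (memR n) maxStat n k b < k - 1) →
        alphaSet (memR n) n k b = Set.Iio k)) := by
  refine ⟨fun b => (alphaSet_memR_subset_Iio hn le_rfl b).antisymm fun x hx =>
    ⟨climbThen n x b, memR_climbThen hx b, climbThen_self n x b, fun i h h' => by omega⟩,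
    fun k hk hkn b hb => ⟨fun h => ?_, fun h => ?_⟩⟩
  · have key : ∀ s, memR n s → (∀ i, k < i → i ≤ n → s i = b i) → s k = k - 1 := by
      intro s hs hsb
      refine eq_pred_of_pred_le_maxStat hs hk hkn.le ?_
      have hmu := muVal_le maxStat hs hsb
      have hstep := hs.2 k hk hkn
      have hlt := maxStat_lt_of_memR hs hk hkn.le
      have hsk := hsb (k + 1) (by omega) hkn
      rw [maxStat_succ] at hmu
      omega
    refine Set.eq_singleton_iff_unique_mem.2 ⟨?_, ?_⟩
    · obtain ⟨s, hs, hsb⟩ := hb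
      exact ⟨s, hs, key s hs hsb, hsb⟩
    · rintro x ⟨s, hs, rfl, hsb⟩
      exact key s hs hsb
  · refine (alphaSet_memR_subset_Iio hk hkn.le b).antisymm fun x hx => ?_
    obtain ⟨s, hs, hsb, hmu⟩ := exists_eq_muVal maxStat hb
    have hsk := hsb (k + 1) (by omega) hkn
    have hle := le_maxStat s (i := k + 1) (by omega) le_rfl
    have huk : climbThen k x s (k + 1) = s (k + 1) := climbThen_of_lt s (by omega)
    have hclimb := le_maxStat_climbThen (k := k) (x := x) s
    refine ⟨climbThen k x s, memR_of_eq_suffix hs (memR_climbThen hx s)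
      (fun i hi _ => climbThen_of_lt s hi) ?_ ?_, climbThen_self k x s,
      fun i hi hin => (climbThen_of_lt s hi).trans (hsb i hi hin)⟩
    · rw [maxStat_succ (climbThen k x s), huk]
      omega
    · omega
end
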